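/- arXiv:math/0401382 — 3 statements merged into one kernel-verified Lean document; each statement's English description precedes it below -/
import Mathlib

section
/- The recurrence coefficients of the monic orthogonal polynomials for w on E satisfy b_n = (−1)^n α for all n ≥ 1, and a_n = (1 − α²)/4 for all n ≥ 2. -/
open MeasureTheory Polynomial

open Real Set in
/-- The map `τ ↦ √(c² + (1 - c²) cos² τ)` carries `(0, π / 2)` onto `(c, 1)`. -/
theorem image_sqrt_cos_sq {c : ℝ} (hc : 0 < c) (hc1 : c < 1) :
    (fun τ ↦ √(c ^ 2 + (1 - c ^ 2) * cos τ ^ 2)) '' Ioo 0 (π / 2) = Ioo c 1 := by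
  have hk : 0 < 1 - c ^ 2 := by nlinarith
  ext x
  constructor
  · rintro ⟨τ, ⟨h0, h1⟩, rfl⟩
    have hcos : 0 < cos τ := cos_pos_of_mem_Ioo ⟨by linarith, h1⟩
    have hsin : 0 < sin τ := sin_pos_of_pos_of_lt_pi h0 (by linarith)
    have hsc := sin_sq_add_cos_sq τ
    constructor
    · apply lt_sqrt_of_sq_lt
      have := mul_pos hk (pow_pos hcos 2)
      linarith
    · rw [sqrt_lt' one_pos]
      nlinarith [mul_pos hk (pow_pos hsin 2)]
  · rintro ⟨hx0, hx1⟩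
    have hq0 : 0 < (x ^ 2 - c ^ 2) / (1 - c ^ 2) := div_pos (by nlinarith) hk
    have hq1 : (x ^ 2 - c ^ 2) / (1 - c ^ 2) < 1 := by
      rw [div_lt_one hk]; nlinarith
    refine ⟨arccos √((x ^ 2 - c ^ 2) / (1 - c ^ 2)), ⟨?_, ?_⟩, ?_⟩
    · rw [arccos_pos, sqrt_lt' one_pos]; simpa using hq1
    · rw [arccos_lt_pi_div_two]; exact sqrt_pos.2 hq0
    · have h1 : √((x ^ 2 - c ^ 2) / (1 - c ^ 2)) ≤ 1 :=
        sqrt_le_iff.2 ⟨zero_le_one, by simpa using hq1.le⟩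
      simp only
      rw [cos_arccos (by linarith [sqrt_nonneg ((x ^ 2 - c ^ 2) / (1 - c ^ 2))]) h1,
        sq_sqrt hq0.le, mul_div_cancel₀ _ hk.ne', add_sub_cancel]
      exact sqrt_sq (by linarith)

open Real Set in
/-- Folding the two intervals onto `[c, 1]` and substituting `x² = c² + (1 - c²) cos² τ`
turns integration against the weight into integration over `(0, π / 2)`. -/
theorem setIntegral_mul_weight {c : ℝ} (hc : 0 < c) (hc1 : c < 1) {w : ℝ → ℝ}
    (hw : ∀ x, w x = 1 / π * √((x + c) / ((1 - x ^ 2) * (x - c))))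
    (hwint : IntegrableOn w (Icc (-1) (-c) ∪ Icc c 1)) {f : ℝ → ℝ} (hf : Continuous f) :
    ∫ x in Icc (-1) (-c) ∪ Icc c 1, f x * w x =
      ∫ τ in Ioo 0 (π / 2), 1 / π *
        ((f √(c ^ 2 + (1 - c ^ 2) * cos τ ^ 2) * (√(c ^ 2 + (1 - c ^ 2) * cos τ ^ 2) + c) +
          f (-√(c ^ 2 + (1 - c ^ 2) * cos τ ^ 2)) * (√(c ^ 2 + (1 - c ^ 2) * cos τ ^ 2) - c)) /
            √(c ^ 2 + (1 - c ^ 2) * cos τ ^ 2)) := by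
  have hk : 0 < 1 - c ^ 2 := by nlinarith
  have hfw : IntegrableOn (fun x ↦ f x * w x) (Icc (-1) (-c) ∪ Icc c 1) :=
    hwint.continuousOn_mul hf.continuousOn (isCompact_Icc.union isCompact_Icc)
  have hneg : IntegrableOn (fun x ↦ f x * w x) (Icc (-1) (-c)) := hfw.mono_set subset_union_left
  have hpos : IntegrableOn (fun x ↦ f x * w x) (Icc c 1) := hfw.mono_set subset_union_right
  have hdisj : Disjoint (Icc (-1) (-c)) (Icc c 1) := by
    rw [Set.disjoint_left]
    rintro x ⟨_, h1⟩ ⟨h2, _⟩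
    linarith
  have hreflint : IntegrableOn (fun x ↦ f (-x) * w (-x)) (Icc c 1) := by
    rw [← intervalIntegrable_iff_integrableOn_Icc_of_le (by linarith)] at hneg ⊢
    simpa using ((IntervalIntegrable.iff_comp_neg enorm_ne_top).1 hneg).symm
  have hrefl : ∫ x in Icc (-1) (-c), f x * w x = ∫ x in Icc c 1, f (-x) * w (-x) := by
    rw [integral_Icc_eq_integral_Ioc, integral_Icc_eq_integral_Ioc,
      ← intervalIntegral.integral_of_le (by linarith),
      ← intervalIntegral.integral_of_le (by linarith)]
    exact (intervalIntegral.integral_comp_neg (fun x ↦ f x * w x)).symm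
  rw [setIntegral_union hdisj measurableSet_Icc hneg hpos, hrefl,
    ← integral_add hreflint hpos, integral_Icc_eq_integral_Ioo, ← image_sqrt_cos_sq hc hc1]
  have hφpos (τ : ℝ) : 0 < c ^ 2 + (1 - c ^ 2) * cos τ ^ 2 := by positivity
  rw [integral_image_eq_integral_abs_deriv_smul (f' := fun τ ↦
    -((1 - c ^ 2) * (cos τ * sin τ)) / √(c ^ 2 + (1 - c ^ 2) * cos τ ^ 2)) measurableSet_Ioo]
  · refine setIntegral_congr_fun measurableSet_Ioo fun τ hτ ↦ ?_
    have hcos : 0 < cos τ := cos_pos_of_mem_Ioo ⟨by linarith [hτ.1, pi_pos], hτ.2⟩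
    have hsin : 0 < sin τ := sin_pos_of_pos_of_lt_pi hτ.1 (by linarith [hτ.2, pi_pos])
    have hmem : √(c ^ 2 + (1 - c ^ 2) * cos τ ^ 2) ∈ Ioo c 1 :=
      image_sqrt_cos_sq hc hc1 ▸ mem_image_of_mem _ hτ
    have hsq := sq_sqrt (hφpos τ).le
    simp only [smul_eq_mul]
    set φ := √(c ^ 2 + (1 - c ^ 2) * cos τ ^ 2)
    obtain ⟨hcφ, hφ1⟩ := hmem
    have hφ0 : 0 < φ := hc.trans hcφ
    have hD : 0 < (1 - c ^ 2) * (cos τ * sin τ) := by positivity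
    have hD2 : ((1 - c ^ 2) * (cos τ * sin τ)) ^ 2 = (1 - φ ^ 2) * (φ ^ 2 - c ^ 2) := by
      rw [hsq, mul_pow, mul_pow, sin_sq]; ring
    have h1 : 0 < 1 - φ ^ 2 := by nlinarith
    have h2 : 0 < φ - c := by linarith
    have h3 : 0 < φ + c := by linarith
    have hwp : w φ = 1 / π * ((φ + c) / ((1 - c ^ 2) * (cos τ * sin τ))) := by
      rw [hw, ← sqrt_sq (div_pos h3 hD).le, div_pow, hD2]
      congr 2
      rw [show φ ^ 2 - c ^ 2 = (φ - c) * (φ + c) by ring]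
      field_simp
    have hwn : w (-φ) = 1 / π * ((φ - c) / ((1 - c ^ 2) * (cos τ * sin τ))) := by
      rw [hw, ← sqrt_sq (div_pos h2 hD).le, div_pow, hD2]
      congr 2
      rw [show φ ^ 2 - c ^ 2 = (φ - c) * (φ + c) by ring, neg_sq,
        show -φ + c = -(φ - c) by ring, show -φ - c = -(φ + c) by ring]
      field_simp
    rw [hwp, hwn, abs_div, abs_neg, abs_of_pos hD, abs_of_pos hφ0]
    field_simp
    ring
  · intro τ _
    have := ((((hasDerivAt_cos τ).pow 2).const_mul (1 - c ^ 2)).const_add (c ^ 2)).sqrt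
      (hφpos τ).ne'
    convert! this.hasDerivWithinAt using 1
    have := (sqrt_pos.2 (hφpos τ)).ne'
    simp
    field_simp
  · intro s hs t ht hst
    have hinj := (sqrt_inj (hφpos s).le (hφpos t).le).1 hst
    have hcs : 0 < cos s := cos_pos_of_mem_Ioo ⟨by linarith [hs.1, pi_pos], hs.2⟩
    have hct : 0 < cos t := cos_pos_of_mem_Ioo ⟨by linarith [ht.1, pi_pos], ht.2⟩
    have hcc : cos s = cos t := by
      rw [← sq_eq_sq₀ hcs.le hct.le]
      exact mul_left_cancel₀ hk.ne' (add_left_cancel hinj)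
    exact injOn_cos ⟨hs.1.le, by linarith [hs.2, pi_pos]⟩ ⟨ht.1.le, by linarith [ht.2, pi_pos]⟩ hcc

open Real in
theorem setIntegral_cos_even_mul {m : ℕ} (hm : m ≠ 0) :
    ∫ τ in Set.Ioo 0 (π / 2), cos (2 * m * τ) = 0 := by
  have hm' : (2 * m : ℝ) ≠ 0 := by positivity
  rw [← integral_Ioc_eq_integral_Ioo, ← intervalIntegral.integral_of_le (by positivity),
    intervalIntegral.integral_comp_mul_left (fun x ↦ cos x) hm', integral_cos,
    show 2 * (m : ℝ) * (π / 2) = m * π by ring]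
  simp [sin_nat_mul_pi]

open Real in
theorem setIntegral_cos_mul_cos (n : ℕ) :
    ∫ τ in Set.Ioo 0 (π / 2), cos ((n + 2 : ℕ) * τ) * cos (n * τ) = 0 := by
  have key (τ : ℝ) : cos ((n + 2 : ℕ) * τ) * cos (n * τ) =
      2⁻¹ * (cos (2 * (n + 1 : ℕ) * τ) + cos (2 * (1 : ℕ) * τ)) := by
    rw [show 2 * ((n + 1 : ℕ) : ℝ) * τ = (n + 2 : ℕ) * τ + n * τ by push_cast; ring,
      show 2 * ((1 : ℕ) : ℝ) * τ = (n + 2 : ℕ) * τ - n * τ by push_cast; ring, cos_add, cos_sub]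
    ring
  have hint (m : ℕ) : IntegrableOn (fun τ ↦ cos (2 * m * τ)) (Set.Ioo 0 (π / 2)) :=
    (Continuous.integrableOn_Icc (by fun_prop)).mono_set Set.Ioo_subset_Icc_self
  simp_rw [key]
  rw [integral_const_mul, integral_add (hint _) (hint _),
    setIntegral_cos_even_mul n.succ_ne_zero, setIntegral_cos_even_mul one_ne_zero]
  simp

/-- The monic polynomials with recurrence coefficients `bₙ = (-1)ⁿ⁺¹ c`, `a₁ = (1 - c²) / 2` and
`aₙ = (1 - c²) / 4` for `n ≥ 2`. -/
noncomputable def twoIntervalPoly (c : ℝ) : ℕ → ℝ[X]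
  | 0 => 1
  | 1 => X - C c
  | n + 2 => (X - C ((-1) ^ (n + 2) * -c)) * twoIntervalPoly c (n + 1) -
      C (if n = 0 then (1 - c ^ 2) / 2 else (1 - c ^ 2) / 4) * twoIntervalPoly c n

open Real in
theorem eval_twoIntervalPoly {c x τ : ℝ} (hx : x ^ 2 = c ^ 2 + (1 - c ^ 2) * cos τ ^ 2)
    (hτ : cos τ ≠ 0) (n : ℕ) :
    (twoIntervalPoly c (2 * n + 1)).eval x =
        (x - c) * ((1 - c ^ 2) / 4) ^ n * cos ((2 * n + 1 : ℕ) * τ) / cos τ ∧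
      (twoIntervalPoly c (2 * n + 2)).eval x =
        2 * ((1 - c ^ 2) / 4) ^ (n + 1) * cos ((2 * n + 2 : ℕ) * τ) := by
  have even_step (m : ℕ) : (-1 : ℝ) ^ (2 * m + 2) = 1 := by
    rw [show 2 * m + 2 = 2 * (m + 1) by ring, pow_mul]; simp
  induction n with
  | zero =>
    constructor
    · simp [twoIntervalPoly, hτ]
    · simp only [twoIntervalPoly]
      simp [cos_two_mul]
      linear_combination hx
  | succ n ih =>
    obtain ⟨ih1, ih2⟩ := ih
    have hodd : (twoIntervalPoly c (2 * (n + 1) + 1)).eval x =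
        (x - c) * ((1 - c ^ 2) / 4) ^ (n + 1) * cos ((2 * (n + 1) + 1 : ℕ) * τ) / cos τ := by
      rw [show 2 * (n + 1) + 1 = (2 * n + 1) + 2 by ring, twoIntervalPoly,
        show 2 * n + 1 + 1 = 2 * n + 2 by ring, pow_add, pow_succ, pow_mul]
      simp only [eval_sub, eval_mul, eval_X, eval_C, ih1, ih2]
      have h1 : cos ((2 * n + 1 + 2 : ℕ) * τ) =
          2 * cos ((2 * n + 2 : ℕ) * τ) * cos τ - cos ((2 * n + 1 : ℕ) * τ) := by
        rw [show ((2 * n + 1 + 2 : ℕ) : ℝ) * τ = (2 * n + 2 : ℕ) * τ + τ by push_cast; ring,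
          show ((2 * n + 1 : ℕ) : ℝ) * τ = (2 * n + 2 : ℕ) * τ - τ by push_cast; ring,
          cos_add, cos_sub]
        ring
      rw [h1]
      simp
      field_simp
      ring
    refine ⟨hodd, ?_⟩
    rw [show 2 * (n + 1) + 2 = (2 * n + 2) + 2 by ring, twoIntervalPoly,
      show 2 * n + 2 + 1 = 2 * (n + 1) + 1 by ring]
    simp only [eval_sub, eval_mul, eval_X, eval_C, hodd, ih2]
    have h1 : cos ((2 * n + 2 + 2 : ℕ) * τ) =
        2 * cos ((2 * (n + 1) + 1 : ℕ) * τ) * cos τ - cos ((2 * n + 2 : ℕ) * τ) := by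
      rw [show ((2 * n + 2 + 2 : ℕ) : ℝ) * τ = (2 * (n + 1) + 1 : ℕ) * τ + τ by push_cast; ring,
        show ((2 * n + 2 : ℕ) : ℝ) * τ = (2 * (n + 1) + 1 : ℕ) * τ - τ by push_cast; ring,
        cos_add, cos_sub]
      ring
    have hx' : (x + c) * (x - c) = 4 * ((1 - c ^ 2) / 4) * cos τ ^ 2 := by linear_combination hx
    rw [h1, show 2 * n + 2 + 2 = 2 * (n + 1) + 2 by ring, even_step, if_neg (by lia)]
    generalize (1 - c ^ 2) / 4 = a at hx' ⊢
    generalize cos ((2 * (n + 1) + 1 : ℕ) * τ) = A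
    field_simp
    linear_combination (a ^ (n + 1) * A) * hx'

/-- Two consecutive three-term recurrence coefficients are determined by orthogonality of the
next polynomial to its two predecessors. -/
theorem recurrence_coeff_unique (L : ℝ[X] →ₗ[ℝ] ℝ) {p q r s : ℝ[X]} {a a' b b' : ℝ}
    (hpp : L (p * p) ≠ 0) (hqq : L (q * q) ≠ 0) (hqp : L (q * p) = 0)
    (hr : r = (X - C b) * q - C a * p) (hs : s = (X - C b') * q - C a' * p)
    (hrq : L (r * q) = 0) (hrp : L (r * p) = 0) (hsq : L (s * q) = 0) (hsp : L (s * p) = 0) :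
    b = b' ∧ a = a' := by
  have h1 : r * q - s * q = (b' - b) • (q * q) + (a' - a) • (q * p) := by
    simp only [smul_eq_C_mul, hr, hs, C_sub]; ring
  have h2 : r * p - s * p = (b' - b) • (q * p) + (a' - a) • (p * p) := by
    simp only [smul_eq_C_mul, hr, hs, C_sub]; ring
  apply_fun L at h1 h2
  simp only [map_sub, map_add, map_smul, hrq, hsq, hrp, hsp, hqp, smul_eq_mul, sub_self, mul_zero,
    zero_add, add_zero, zero_eq_mul, hpp, hqq, or_false, sub_eq_zero] at h1 h2
  exact ⟨h1.symm, h2.symm⟩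

open Real Set in
theorem integral_eval_mul_weight_eq_zero {c : ℝ} (hc : 0 < c) (hc1 : c < 1) {w : ℝ → ℝ}
    (hw : ∀ x, w x = 1 / π * √((x + c) / ((1 - x ^ 2) * (x - c))))
    (hwint : IntegrableOn w (Icc (-1) (-c) ∪ Icc c 1))
    {p : ℝ[X]} {n : ℕ} {K : ℝ}
    (hp : ∀ φ τ, φ ^ 2 = c ^ 2 + (1 - c ^ 2) * cos τ ^ 2 → cos τ ≠ 0 → φ ≠ 0 →
      (p.eval φ * (φ + c) + p.eval (-φ) * (φ - c)) / φ =
        K * (cos ((n + 2 : ℕ) * τ) * cos (n * τ))) :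
    ∫ x in Icc (-1) (-c) ∪ Icc c 1, p.eval x * w x = 0 := by
  have hk : 0 < 1 - c ^ 2 := by nlinarith
  rw [setIntegral_mul_weight hc hc1 hw hwint p.continuous]
  calc _ = ∫ τ in Ioo 0 (π / 2), 1 / π * (K * (cos ((n + 2 : ℕ) * τ) * cos (n * τ))) := by
        refine setIntegral_congr_fun measurableSet_Ioo fun τ hτ ↦ ?_
        have hcos : 0 < cos τ := cos_pos_of_mem_Ioo ⟨by linarith [hτ.1, pi_pos], hτ.2⟩
        have hpos : 0 < c ^ 2 + (1 - c ^ 2) * cos τ ^ 2 := by positivity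
        rw [hp _ τ (sq_sqrt hpos.le) hcos.ne' (sqrt_pos.2 hpos).ne']
    _ = 0 := by rw [integral_const_mul, integral_const_mul, setIntegral_cos_mul_cos]; simp

open Real Set in
/-- Consecutive polynomials of the family are orthogonal. -/
theorem integral_twoIntervalPoly_succ {c : ℝ} (hc : 0 < c) (hc1 : c < 1) {w : ℝ → ℝ}
    (hw : ∀ x, w x = 1 / π * √((x + c) / ((1 - x ^ 2) * (x - c))))
    (hwint : IntegrableOn w (Icc (-1) (-c) ∪ Icc c 1))
    (n : ℕ) :
    ∫ x in Icc (-1) (-c) ∪ Icc c 1,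
      (twoIntervalPoly c (n + 1) * twoIntervalPoly c n).eval x * w x = 0 := by
  refine integral_eval_mul_weight_eq_zero hc hc1 hw hwint (n := 0) (K := 0) ?_
  intro φ τ hφ hτ hφ0
  have hφ' : (-φ) ^ 2 = c ^ 2 + (1 - c ^ 2) * cos τ ^ 2 := by rw [neg_sq, hφ]
  rw [zero_mul, div_eq_zero_iff]
  left
  rcases n with _ | n
  · simp [twoIntervalPoly]; ring
  obtain ⟨m, rfl | rfl⟩ := n.even_or_odd'
  · simp only [eval_mul, (eval_twoIntervalPoly hφ hτ m).1, (eval_twoIntervalPoly hφ hτ m).2,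
      (eval_twoIntervalPoly hφ' hτ m).1, (eval_twoIntervalPoly hφ' hτ m).2]
    ring
  · rw [show 2 * m + 1 + 1 + 1 = 2 * (m + 1) + 1 by ring]
    simp only [eval_mul, (eval_twoIntervalPoly hφ hτ (m + 1)).1, (eval_twoIntervalPoly hφ hτ m).2,
      (eval_twoIntervalPoly hφ' hτ (m + 1)).1, (eval_twoIntervalPoly hφ' hτ m).2]
    ring

open Real Set in
/-- Polynomials of the family two steps apart are orthogonal. -/
theorem integral_twoIntervalPoly_add_two {c : ℝ} (hc : 0 < c) (hc1 : c < 1) {w : ℝ → ℝ}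
    (hw : ∀ x, w x = 1 / π * √((x + c) / ((1 - x ^ 2) * (x - c))))
    (hwint : IntegrableOn w (Icc (-1) (-c) ∪ Icc c 1))
    (n : ℕ) :
    ∫ x in Icc (-1) (-c) ∪ Icc c 1,
      (twoIntervalPoly c (n + 2) * twoIntervalPoly c n).eval x * w x = 0 := by
  rcases n with _ | n
  · refine integral_eval_mul_weight_eq_zero hc hc1 hw hwint (n := 0) (K := 1 - c ^ 2) ?_
    intro φ τ hφ hτ hφ0
    have hφ' : (-φ) ^ 2 = c ^ 2 + (1 - c ^ 2) * cos τ ^ 2 := by rw [neg_sq, hφ]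
    have h1 := (eval_twoIntervalPoly hφ hτ 0).2
    have h2 := (eval_twoIntervalPoly hφ' hτ 0).2
    simp only [mul_zero, zero_add] at h1 h2
    simp only [eval_mul, zero_add, h1, h2, twoIntervalPoly.eq_1, eval_one]
    simp
    field_simp
    ring
  obtain ⟨m, rfl | rfl⟩ := n.even_or_odd'
  · refine integral_eval_mul_weight_eq_zero hc hc1 hw hwint (n := 2 * m + 1)
      (K := 2 * (1 - c ^ 2) * ((1 - c ^ 2) / 4) ^ (2 * m + 1)) ?_
    intro φ τ hφ hτ hφ0
    have hφ' : (-φ) ^ 2 = c ^ 2 + (1 - c ^ 2) * cos τ ^ 2 := by rw [neg_sq, hφ]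
    rw [show 2 * m + 1 + 2 = 2 * (m + 1) + 1 by ring]
    simp only [eval_mul, (eval_twoIntervalPoly hφ hτ m).1, (eval_twoIntervalPoly hφ hτ (m + 1)).1,
      (eval_twoIntervalPoly hφ' hτ m).1, (eval_twoIntervalPoly hφ' hτ (m + 1)).1]
    generalize cos ((2 * (m + 1) + 1 : ℕ) * τ) = A
    generalize cos ((2 * m + 1 : ℕ) * τ) = B
    generalize (1 - c ^ 2) / 4 = a
    field_simp
    linear_combination (2 * φ * a ^ (2 * m + 1) * A * B) * hφ
  · refine integral_eval_mul_weight_eq_zero hc hc1 hw hwint (n := 2 * m + 2)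
      (K := 8 * ((1 - c ^ 2) / 4) ^ (2 * m + 3)) ?_
    intro φ τ hφ hτ hφ0
    have hφ' : (-φ) ^ 2 = c ^ 2 + (1 - c ^ 2) * cos τ ^ 2 := by rw [neg_sq, hφ]
    rw [show 2 * m + 1 + 1 = 2 * m + 2 by ring, show 2 * m + 2 + 2 = 2 * (m + 1) + 2 by ring]
    simp only [eval_mul, (eval_twoIntervalPoly hφ hτ m).2, (eval_twoIntervalPoly hφ hτ (m + 1)).2,
      (eval_twoIntervalPoly hφ' hτ m).2, (eval_twoIntervalPoly hφ' hτ (m + 1)).2]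
    generalize cos ((2 * (m + 1) + 2 : ℕ) * τ) = A
    generalize cos ((2 * m + 2 : ℕ) * τ) = B
    generalize (1 - c ^ 2) / 4 = a
    field_simp
    ring

/-- for the symmetric two-interval case the recurrence coefficients are
`bₙ = (−1)ⁿ α` and `aₙ = (1 − α²)/4` for `n ≥ 2`. -/
theorem symmetric_recurrence_coefficients
    (α : ℝ) (hα : -1 < α) (hα0 : α < 0)
    (E : Set ℝ) (hE : E = Set.Icc (-1) α ∪ Set.Icc (-α) 1)
    (w : ℝ → ℝ)
    (hw : ∀ x, w x = (1 / Real.pi) * Real.sqrt ((x - α) / ((1 - x ^ 2) * (x + α))))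
    (hw0 : ∀ x ∈ E, 0 ≤ w x)
    (hwint : MeasureTheory.IntegrableOn w E)
    (P : ℕ → Polynomial ℝ) (h : ℕ → ℝ) (a b : ℕ → ℝ)
    (hPmonic : ∀ n, (P n).Monic)
    (hPdeg : ∀ n, (P n).natDegree = n)
    (hh : ∀ n, 0 < h n)
    (horth : ∀ n m, ∫ x in E, (P n).eval x * (P m).eval x * w x = if n = m then h n else 0)
    (ha : ∀ n, 1 ≤ n → 0 < a n)
    (hrec0 : P 1 = (Polynomial.X - Polynomial.C (b 1)) * P 0)
    (hrec : ∀ n, 1 ≤ n →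
      P (n + 1) = (Polynomial.X - Polynomial.C (b (n + 1))) * P n - Polynomial.C (a n) * P (n - 1)) :
    (∀ n, 1 ≤ n → b n = (-1 : ℝ) ^ n * α) ∧ (∀ n, 2 ≤ n → a n = (1 - α ^ 2) / 4) := by
  obtain ⟨c, rfl⟩ : ∃ c, α = -c := ⟨-α, (neg_neg α).symm⟩
  have hc : 0 < c := by linarith
  have hc1 : c < 1 := by linarith
  subst hE
  simp only [neg_neg, sub_neg_eq_add, ← sub_eq_add_neg] at *
  have hint (p : ℝ[X]) : IntegrableOn (fun x ↦ p.eval x * w x)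
      (Set.Icc (-1) (-c) ∪ Set.Icc c 1) :=
    hwint.continuousOn_mul p.continuous.continuousOn (isCompact_Icc.union isCompact_Icc)
  let L : ℝ[X] →ₗ[ℝ] ℝ :=
    { toFun p := ∫ x in Set.Icc (-1) (-c) ∪ Set.Icc c 1, p.eval x * w x
      map_add' p q := by
        simp only [eval_add, add_mul]
        exact integral_add (hint p) (hint q)
      map_smul' k p := by
        simp only [eval_smul, smul_eq_mul, mul_assoc, integral_const_mul, RingHom.id_apply] }
  have hL (n m : ℕ) : L (P n * P m) = if n = m then h n else 0 := by
    simpa only [L, LinearMap.coe_mk, AddHom.coe_mk, eval_mul] using horth n m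
  have hself (n : ℕ) : L (P n * P n) ≠ 0 := by simpa [hL] using (hh n).ne'
  have hL1 (n : ℕ) : L (twoIntervalPoly c (n + 1) * twoIntervalPoly c n) = 0 :=
    integral_twoIntervalPoly_succ hc hc1 hw hwint n
  have hL2 (n : ℕ) : L (twoIntervalPoly c (n + 2) * twoIntervalPoly c n) = 0 :=
    integral_twoIntervalPoly_add_two hc hc1 hw hwint n
  have hP0 : P 0 = 1 := (hPmonic 0).natDegree_eq_zero.1 (hPdeg 0)
  have hb1 : b 1 = c := by
    have h1 : P 1 * P 0 - twoIntervalPoly c (0 + 1) * twoIntervalPoly c 0 =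
        (c - b 1) • (P 0 * P 0) := by
      simp only [hrec0, hP0, twoIntervalPoly, smul_eq_C_mul, C_sub]; ring
    apply_fun L at h1
    rw [map_sub, hL1, hL, map_smul, smul_eq_mul, if_neg one_ne_zero, sub_self, zero_eq_mul] at h1
    linarith [h1.resolve_right (hself 0)]
  have step (n : ℕ) (h0 : P n = twoIntervalPoly c n) (h1 : P (n + 1) = twoIntervalPoly c (n + 1)) :
      b (n + 2) = (-1) ^ (n + 2) * -c ∧
        a (n + 1) = if n = 0 then (1 - c ^ 2) / 2 else (1 - c ^ 2) / 4 := by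
    refine recurrence_coeff_unique L (p := P n) (q := P (n + 1)) (r := P (n + 2))
      (s := twoIntervalPoly c (n + 2)) (hself n) (hself (n + 1)) ?_ (hrec (n + 1) (by lia)) ?_
      ?_ ?_ ?_ ?_
    · simp [hL]
    · rw [twoIntervalPoly, h0, h1]
    · simp [hL]
    · simp [hL]
    · rw [h1]; exact hL1 (n + 1)
    · rw [h0]; exact hL2 n
  have hP (n : ℕ) : P n = twoIntervalPoly c n ∧ P (n + 1) = twoIntervalPoly c (n + 1) := by
    induction n with
    | zero => exact ⟨hP0, by simp [hrec0, hP0, hb1, twoIntervalPoly]⟩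
    | succ n ih =>
      refine ⟨ih.2, ?_⟩
      obtain ⟨hb, ha'⟩ := step n ih.1 ih.2
      rw [hrec (n + 1) (by lia), twoIntervalPoly, hb, ha', Nat.add_sub_cancel, ih.1, ih.2]
  refine ⟨fun n hn ↦ ?_, fun n hn ↦ ?_⟩
  · obtain rfl | ⟨m, rfl⟩ : n = 1 ∨ ∃ m, n = m + 2 := by
      rcases hn.eq_or_lt with h | h
      · exact Or.inl h.symm
      · exact Or.inr ⟨n - 2, by lia⟩
    · simp [hb1]
    · exact (step m (hP m).1 (hP m).2).1
  · obtain ⟨m, rfl⟩ : ∃ m, n = m + 2 := ⟨n - 2, by lia⟩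
    simpa using (step (m + 1) (hP (m + 1)).1 (hP (m + 1)).2).2
end

section
/- For every m ≥ 1, writing n := 2m, the polynomial P_{2m} satisfies the differential equation x (x² − α²)(1 − x²) · P_{2m}''(x) − (x⁴ − α²) · P_{2m}'(x) + n² x³ · P_{2m}(x) = 0 for all real x (this is the equation P'' − ((x⁴ − α²)/(x(x² − α²)(1 − x²))) P' + (n² x²/((1 − x²)(x² − α²))) P = 0 cleared of denominators). -/
open Polynomial

/-- the differential equation satisfied by `P_{2m}`. -/
theorem P_even_differential_equation
    (α : ℝ) (hα : -1 < α) (hα0 : α < 0)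
    (Δ : ℝ) (hΔ : Δ = (1 - α ^ 2) / 2)
    (That : ℕ → Polynomial ℝ)
    (hThat : ∀ m : ℕ, That m = Polynomial.C ((2 : ℝ) ^ (1 - (m : ℤ))) * Polynomial.Chebyshev.T ℝ m)
    (P : ℕ → Polynomial ℝ)
    (hP : ∀ m : ℕ, 1 ≤ m →
      P (2 * m) = Polynomial.C (Δ ^ m) *
        (That m).comp (Polynomial.C (1 / Δ) * (Polynomial.X ^ 2 + Polynomial.C (Δ - 1))))
    (m : ℕ) (hm : 1 ≤ m) :
    ∀ x : ℝ,
      x * (x ^ 2 - α ^ 2) * (1 - x ^ 2) *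
          (Polynomial.derivative (Polynomial.derivative (P (2 * m)))).eval x
        - (x ^ 4 - α ^ 2) * (Polynomial.derivative (P (2 * m))).eval x
        + ((2 * m : ℕ) : ℝ) ^ 2 * x ^ 3 * (P (2 * m)).eval x = 0 := by
  intro x
  have hΔ0 : Δ ≠ 0 := by nlinarith
  have hα2 : α ^ 2 = 1 - 2 * Δ := by linarith
  have hT := congr_arg (eval (1 / Δ * (x ^ 2 + (Δ - 1))))
    (Chebyshev.one_sub_X_sq_mul_derivative_derivative_T_eq_poly_in_T (R := ℝ) m)
  simp only [Function.iterate_succ, Function.iterate_zero, Function.comp_apply, id, eval_sub,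
    eval_mul, eval_pow, eval_X, eval_one, Int.cast_natCast, eval_natCast] at hT
  rw [hP m hm, hThat m, hα2]
  simp only [derivative_mul, derivative_C, derivative_comp, derivative_add, derivative_X_pow,
    derivative_X, mul_comp, C_comp, eval_add, eval_mul, eval_pow, eval_X, eval_C, eval_comp,
    zero_mul, zero_add, add_zero, Nat.cast_ofNat, Nat.cast_mul, pow_one,
    mul_one, Nat.add_one_sub_one]
  generalize eval _ (derivative (derivative (Chebyshev.T ℝ m))) = a at *
  generalize eval _ (derivative (Chebyshev.T ℝ m)) = b at *
  generalize eval _ (Chebyshev.T ℝ m) = c at *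
  generalize (2 : ℝ) ^ (1 - (m : ℤ)) = d at *
  field_simp at hT ⊢
  linear_combination 4 * x ^ 3 * d * Δ ^ m * hT
end

section
/- The monic orthogonal polynomials for w on E satisfy P_1(x) = x + 2α + 1, P_2(x) = x² + (α + 1/2) x − 1/2, and P_3(x) = x³ − (1 + α + α²) x; equivalently, the recurrence coefficients satisfy b_1 = −(1 + 2α), b_2 = b_3 = 1/2 + α, a_1 = −2α(1 + α), a_2 = 1/4, and a_3 = −α(1 + α). -/
open MeasureTheory Polynomial

/-- The roots `(-x + ε √(4s - 3x²)) / 2`, `ε = ±1`, other than `x`, of `t³ - s t = x³ - s x`. -/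
noncomputable def conjRoot (s ε x : ℝ) : ℝ := (-x + ε * √(4 * s - 3 * x ^ 2)) / 2

/-- The derivative of `conjRoot s ε`. -/
noncomputable def conjRootDeriv (s ε x : ℝ) : ℝ := (-1 - ε * (3 * x / √(4 * s - 3 * x ^ 2))) / 2

lemma conjRoot_hasDerivAt {s ε x : ℝ} (h : 0 < 4 * s - 3 * x ^ 2) :
    HasDerivAt (conjRoot s ε) (conjRootDeriv s ε x) x := by
  have h1 : HasDerivAt (fun x : ℝ => 4 * s - 3 * x ^ 2) (-(6 * x)) x := by
    have := ((hasDerivAt_pow 2 x).const_mul 3).const_sub (4 * s)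
    exact this.congr_deriv (by push_cast; ring)
  have h2 := (((hasDerivAt_id x).neg).add ((h1.sqrt h.ne').const_mul ε)).div_const 2
  refine h2.congr_deriv ?_
  have : √(4 * s - 3 * x ^ 2) ≠ 0 := (Real.sqrt_pos.2 h).ne'
  unfold conjRootDeriv
  field_simp
  ring

lemma integral_image_Icc_of_conjRoot {s ε p q l u : ℝ}
    (hdisc : ∀ x ∈ Set.Icc p q, 0 < 4 * s - 3 * x ^ 2)
    (himg : conjRoot s ε '' Set.Icc p q = Set.Icc l u)
    (hinj : Set.InjOn (conjRoot s ε) (Set.Icc p q)) (g : ℝ → ℝ) :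
    (IntegrableOn g (Set.Icc l u) ↔
      IntegrableOn (fun x => |conjRootDeriv s ε x| * g (conjRoot s ε x)) (Set.Ioo p q)) ∧
    ∫ x in Set.Icc l u, g x =
      ∫ x in Set.Ioo p q, |conjRootDeriv s ε x| * g (conjRoot s ε x) := by
  have hd : ∀ x ∈ Set.Icc p q,
      HasDerivWithinAt (conjRoot s ε) (conjRootDeriv s ε x) (Set.Icc p q) x :=
    fun x hx => (conjRoot_hasDerivAt (hdisc x hx)).hasDerivWithinAt
  rw [← himg]
  constructor
  · rw [integrableOn_image_iff_integrableOn_abs_deriv_smul measurableSet_Icc hd hinj g,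
      integrableOn_Icc_iff_integrableOn_Ioo]
    rfl
  · rw [integral_image_eq_integral_abs_deriv_smul measurableSet_Icc hd hinj g,
      integral_Icc_eq_integral_Ioo]
    rfl

lemma conjRoot_neg_one_image {α : ℝ} (hα : -1 < α) (hα2 : α < -(1 / 2)) :
    conjRoot (1 + α + α ^ 2) (-1) '' Set.Icc (-α) 1 = Set.Icc (-1) α ∧
    Set.InjOn (conjRoot (1 + α + α ^ 2) (-1)) (Set.Icc (-α) 1) := by
  have hdisc : ∀ x ∈ Set.Icc (-α) 1, 0 < 4 * (1 + α + α ^ 2) - 3 * x ^ 2 := by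
    rintro x ⟨h1, h2⟩; nlinarith
  have hc : ContinuousOn (conjRoot (1 + α + α ^ 2) (-1)) (Set.Icc (-α) 1) :=
    fun x hx => (conjRoot_hasDerivAt (hdisc x hx)).continuousAt.continuousWithinAt
  have hm : StrictMonoOn (conjRoot (1 + α + α ^ 2) (-1)) (Set.Icc (-α) 1) := by
    refine strictMonoOn_of_deriv_pos (convex_Icc _ _) hc fun x hx => ?_
    rw [interior_Icc] at hx
    have hx' := Set.Ioo_subset_Icc_self hx
    rw [(conjRoot_hasDerivAt (hdisc x hx')).deriv]
    have hs := Real.sqrt_pos.2 (hdisc x hx')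
    have hlt : √(4 * (1 + α + α ^ 2) - 3 * x ^ 2) < 3 * x := by
      rw [Real.sqrt_lt' (by linarith [hx.1])]; nlinarith [hx.1]
    have := (one_lt_div hs).2 hlt
    unfold conjRootDeriv
    linarith
  have e1 : conjRoot (1 + α + α ^ 2) (-1) (-α) = -1 := by
    have : √(4 * (1 + α + α ^ 2) - 3 * (-α) ^ 2) = 2 + α := by
      rw [Real.sqrt_eq_iff_mul_self_eq_of_pos (by linarith)]; ring
    unfold conjRoot; rw [this]; ring
  have e2 : conjRoot (1 + α + α ^ 2) (-1) 1 = α := by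
    have : √(4 * (1 + α + α ^ 2) - 3 * 1 ^ 2) = -1 - 2 * α := by
      rw [Real.sqrt_eq_iff_mul_self_eq_of_pos (by linarith)]; ring
    unfold conjRoot; rw [this]; ring
  refine ⟨Set.Subset.antisymm ?_ ?_, hm.injOn⟩
  · have := hm.monotoneOn.image_Icc_subset; rwa [e1, e2] at this
  · have := intermediate_value_Icc (by linarith) hc; rwa [e1, e2] at this

lemma conjRoot_one_image {α : ℝ} (hα : -1 < α) (hα2 : α < -(1 / 2)) :
    conjRoot (1 + α + α ^ 2) 1 '' Set.Icc (-α) 1 = Set.Icc (-1 - α) (1 + α) ∧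
    Set.InjOn (conjRoot (1 + α + α ^ 2) 1) (Set.Icc (-α) 1) := by
  have hdisc : ∀ x ∈ Set.Icc (-α) 1, 0 < 4 * (1 + α + α ^ 2) - 3 * x ^ 2 := by
    rintro x ⟨h1, h2⟩; nlinarith
  have hc : ContinuousOn (conjRoot (1 + α + α ^ 2) 1) (Set.Icc (-α) 1) :=
    fun x hx => (conjRoot_hasDerivAt (hdisc x hx)).continuousAt.continuousWithinAt
  have hm : StrictAntiOn (conjRoot (1 + α + α ^ 2) 1) (Set.Icc (-α) 1) := by
    refine strictAntiOn_of_deriv_neg (convex_Icc _ _) hc fun x hx => ?_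
    rw [interior_Icc] at hx
    have hx' := Set.Ioo_subset_Icc_self hx
    rw [(conjRoot_hasDerivAt (hdisc x hx')).deriv]
    have hs := Real.sqrt_pos.2 (hdisc x hx')
    have : 0 < 3 * x / √(4 * (1 + α + α ^ 2) - 3 * x ^ 2) :=
      div_pos (by linarith [hx.1]) hs
    unfold conjRootDeriv
    linarith
  have e1 : conjRoot (1 + α + α ^ 2) 1 (-α) = 1 + α := by
    have : √(4 * (1 + α + α ^ 2) - 3 * (-α) ^ 2) = 2 + α := by
      rw [Real.sqrt_eq_iff_mul_self_eq_of_pos (by linarith)]; ring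
    unfold conjRoot; rw [this]; ring
  have e2 : conjRoot (1 + α + α ^ 2) 1 1 = -1 - α := by
    have : √(4 * (1 + α + α ^ 2) - 3 * 1 ^ 2) = -1 - 2 * α := by
      rw [Real.sqrt_eq_iff_mul_self_eq_of_pos (by linarith)]; ring
    unfold conjRoot; rw [this]; ring
  refine ⟨Set.Subset.antisymm ?_ ?_, hm.injOn⟩
  · have := hm.antitoneOn.image_Icc_subset; rwa [e1, e2] at this
  · have := intermediate_value_Icc' (by linarith) hc; rwa [e1, e2] at this

/-- The weight of the symmetric three-interval case. -/
noncomputable def bandWeight (α x : ℝ) : ℝ := (1 / Real.pi) *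
  √((x - α) * (x - 1 - α) / ((1 - x ^ 2) * (x + 1 + α) * (x + α)))

/-- The image of the arcsine measure of `[-c, c]`, `c = -α (1 + α)`, under the inverse branch
of `x³ - (1 + α + α²) x` on the right band. -/
noncomputable def arcsineWeight (α x : ℝ) : ℝ := (1 / Real.pi) *
  ((3 * x ^ 2 - (1 + α + α ^ 2)) /
    √((α * (1 + α)) ^ 2 - (x ^ 3 - (1 + α + α ^ 2) * x) ^ 2))

lemma bandWeight_eq {α t u : ℝ} (hu : u ^ 2 < (α * (1 + α)) ^ 2)
    (ht : t ^ 3 - (1 + α + α ^ 2) * t = u) :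
    bandWeight α t =
      (1 / Real.pi) * (|(t - α) * (t - 1 - α)| / √((α * (1 + α)) ^ 2 - u ^ 2)) := by
  have hpos : 0 < (α * (1 + α)) ^ 2 - u ^ 2 := by linarith
  have hfac : (α * (1 + α)) ^ 2 - u ^ 2 =
      ((t - α) * (t - 1 - α)) * ((1 - t ^ 2) * (t + 1 + α) * (t + α)) := by
    rw [← ht]; ring
  have hD : ((1 - t ^ 2) * (t + 1 + α) * (t + α)) ≠ 0 := by
    intro h0; rw [h0, mul_zero] at hfac; linarith
  have hN : (t - α) * (t - 1 - α) ≠ 0 := by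
    intro h0; rw [h0, zero_mul] at hfac; linarith
  unfold bandWeight
  rw [hfac, ← Real.sqrt_sq_eq_abs, ← Real.sqrt_div (sq_nonneg _)]
  congr 2
  generalize (t - α) * (t - 1 - α) = N at *
  field_simp

lemma abs_mul_bandWeight_eq {α t x d : ℝ}
    (hx : (x ^ 3 - (1 + α + α ^ 2) * x) ^ 2 < (α * (1 + α)) ^ 2)
    (ht : t ^ 3 - (1 + α + α ^ 2) * t = x ^ 3 - (1 + α + α ^ 2) * x)
    (hdx : 0 < 3 * x ^ 2 - (1 + α + α ^ 2))
    (hd : d * (3 * t ^ 2 - (1 + α + α ^ 2)) = 3 * x ^ 2 - (1 + α + α ^ 2))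
    (hsign : 0 ≤ (t - α) * (t - 1 - α) * (3 * t ^ 2 - (1 + α + α ^ 2))) :
    |d| * bandWeight α t =
      (t - α) * (t - 1 - α) / (3 * t ^ 2 - (1 + α + α ^ 2)) * arcsineWeight α x := by
  rw [bandWeight_eq hx ht, arcsineWeight]
  generalize 3 * x ^ 2 - (1 + α + α ^ 2) = r at *
  generalize 3 * t ^ 2 - (1 + α + α ^ 2) = v at *
  generalize (t - α) * (t - 1 - α) = N at *
  have hv : v ≠ 0 := by rintro rfl; simp at hd; linarith
  have hd' : d = r / v := by field_simp; exact hd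
  have : |d| * |N| = N / v * r := by
    rw [hd', ← abs_mul, abs_of_nonneg]
    · field_simp
    · have : r / v * N = r * (N * v) / v ^ 2 := by field_simp
      rw [this]; positivity
  linear_combination (1 / Real.pi) / √((α * (1 + α)) ^ 2 -
    (x ^ 3 - (1 + α + α ^ 2) * x) ^ 2) * this

/-- The sum of `tᵏ (t - α) (t - 1 - α) / (3 t² - s)` over the roots `t` of `t³ - s t = u`, where
`s = 1 + α + α²`. -/
noncomputable def rootSum (α u : ℝ) : ℕ → ℝ
  | 0 => 1
  | 1 => -(1 + 2 * α)
  | 2 => 1 + 2 * α + 2 * α ^ 2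
  | k + 3 => (1 + α + α ^ 2) * rootSum α u (k + 1) + u * rootSum α u k

lemma rootSum_eq {α x y z u : ℝ} (hsum : x + y + z = 0)
    (hs : x * y + y * z + z * x = -(1 + α + α ^ 2))
    (hx : x ^ 3 - (1 + α + α ^ 2) * x = u) (hy : y ^ 3 - (1 + α + α ^ 2) * y = u)
    (hz : z ^ 3 - (1 + α + α ^ 2) * z = u) (hxy : x ≠ y) (hyz : y ≠ z) (hzx : z ≠ x) (k : ℕ) :
    x ^ k * ((x - α) * (x - 1 - α) / (3 * x ^ 2 - (1 + α + α ^ 2))) +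
      y ^ k * ((y - α) * (y - 1 - α) / (3 * y ^ 2 - (1 + α + α ^ 2))) +
      z ^ k * ((z - α) * (z - 1 - α) / (3 * z ^ 2 - (1 + α + α ^ 2))) = rootSum α u k := by
  have hx' : 3 * x ^ 2 - (1 + α + α ^ 2) = -((x - y) * (z - x)) := by
    linear_combination 2 * x * hsum - hs
  have hy' : 3 * y ^ 2 - (1 + α + α ^ 2) = -((y - z) * (x - y)) := by
    linear_combination 2 * y * hsum - hs
  have hz' : 3 * z ^ 2 - (1 + α + α ^ 2) = -((z - x) * (y - z)) := by
    linear_combination 2 * z * hsum - hs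
  have h1 : x - y ≠ 0 := sub_ne_zero.2 hxy
  have h2 : y - z ≠ 0 := sub_ne_zero.2 hyz
  have h3 : z - x ≠ 0 := sub_ne_zero.2 hzx
  rw [hx', hy', hz']
  induction k using rootSum.induct with
  | case1 => rw [rootSum]; field_simp; ring
  | case2 =>
    rw [rootSum]
    trans (x + y + z) - (1 + 2 * α)
    · field_simp; ring
    · rw [hsum]; ring
  | case3 =>
    rw [rootSum]
    trans (x + y + z) ^ 2 - (x * y + y * z + z * x) - (1 + 2 * α) * (x + y + z) + α + α ^ 2
    · field_simp; ring
    · rw [hsum, hs]; ring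
  | case4 k ih1 ih0 =>
    rw [rootSum, ← ih1, ← ih0]
    generalize (x - α) * (x - 1 - α) / _ = A
    generalize (y - α) * (y - 1 - α) / _ = B
    generalize (z - α) * (z - 1 - α) / _ = C
    simp only [Nat.succ_eq_add_one, pow_succ]
    linear_combination x ^ k * A * hx + y ^ k * B * hy + z ^ k * C * hz

lemma weighted_pow_sum_eq {α x : ℝ} (hα : -1 < α) (hα2 : α < -(1 / 2))
    (hx : x ∈ Set.Ioo (-α) 1) (k : ℕ) :
    x ^ k * bandWeight α x +
      |conjRootDeriv (1 + α + α ^ 2) 1 x| * (conjRoot (1 + α + α ^ 2) 1 x ^ k *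
        bandWeight α (conjRoot (1 + α + α ^ 2) 1 x)) +
      |conjRootDeriv (1 + α + α ^ 2) (-1) x| * (conjRoot (1 + α + α ^ 2) (-1) x ^ k *
        bandWeight α (conjRoot (1 + α + α ^ 2) (-1) x)) =
    rootSum α (x ^ 3 - (1 + α + α ^ 2) * x) k * arcsineWeight α x := by
  obtain ⟨hx1, hx2⟩ := hx
  have hdisc : 0 < 4 * (1 + α + α ^ 2) - 3 * x ^ 2 := by nlinarith
  have hD := Real.sqrt_pos.2 hdisc
  have hDsq := Real.sq_sqrt hdisc.le
  have hDx : √(4 * (1 + α + α ^ 2) - 3 * x ^ 2) < 3 * x := by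
    rw [Real.sqrt_lt' (by linarith)]; nlinarith
  have hDy0 : x - 2 - 2 * α < √(4 * (1 + α + α ^ 2) - 3 * x ^ 2) := by
    apply Real.lt_sqrt_of_sq_lt
    nlinarith [mul_pos (sub_pos.2 hx2) (show 0 < x - α by linarith)]
  have hDy1 : √(4 * (1 + α + α ^ 2) - 3 * x ^ 2) < x + 2 + 2 * α := by
    rw [Real.sqrt_lt' (by linarith)]
    nlinarith [mul_pos (show 0 < x + 1 by linarith) (show 0 < x + α by linarith)]
  have hDz0 : √(4 * (1 + α + α ^ 2) - 3 * x ^ 2) < 2 - x := by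
    rw [Real.sqrt_lt' (by linarith)]
    nlinarith [mul_pos (show 0 < x + α by linarith) (show 0 < x - 1 - α by linarith)]
  have hDz1 : -x - 2 * α < √(4 * (1 + α + α ^ 2) - 3 * x ^ 2) := by
    apply Real.lt_sqrt_of_sq_lt
    nlinarith [mul_pos (sub_pos.2 hx2) (show 0 < x + 1 + α by linarith)]
  unfold conjRootDeriv conjRoot
  generalize √(4 * (1 + α + α ^ 2) - 3 * x ^ 2) = D at *
  set y := (-x + 1 * D) / 2 with hy
  set z := (-x + -1 * D) / 2 with hz
  have hsum : x + y + z = 0 := by rw [hy, hz]; ring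
  have hs : x * y + y * z + z * x = -(1 + α + α ^ 2) := by
    rw [hy, hz]; linear_combination -hDsq / 4
  have hyr : y ^ 3 - (1 + α + α ^ 2) * y = x ^ 3 - (1 + α + α ^ 2) * x := by
    have : z = -x - y := by linarith
    rw [this] at hs
    linear_combination (x - y) * hs
  have hzr : z ^ 3 - (1 + α + α ^ 2) * z = x ^ 3 - (1 + α + α ^ 2) * x := by
    have : y = -x - z := by linarith
    rw [this] at hs
    linear_combination (x - z) * hs
  have hy0 : -1 - α < y := by linarith
  have hy1 : y < 1 + α := by linarith
  have hz0 : -1 < z := by linarith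
  have hz1 : z < α := by linarith
  have hdx : 3 * x ^ 2 - (1 + α + α ^ 2) = (x - y) * (x - z) := by
    linear_combination 2 * x * hsum - hs
  have hdy : 3 * y ^ 2 - (1 + α + α ^ 2) = (y - z) * (y - x) := by
    linear_combination 2 * y * hsum - hs
  have hdz : 3 * z ^ 2 - (1 + α + α ^ 2) = (z - x) * (z - y) := by
    linear_combination 2 * z * hsum - hs
  have hdpos : 0 < 3 * x ^ 2 - (1 + α + α ^ 2) := by
    rw [hdx]; exact mul_pos (by linarith) (by linarith)
  have hxu : (x ^ 3 - (1 + α + α ^ 2) * x) ^ 2 < (α * (1 + α)) ^ 2 := by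
    have : 0 < ((1 - x) * (1 + x)) * (((x - α) * (x + 1 + α)) * ((x - 1 - α) * (x + α))) := by
      apply mul_pos (mul_pos _ _) (mul_pos (mul_pos _ _) (mul_pos _ _)) <;> linarith
    linarith
  have ex := abs_mul_bandWeight_eq (d := 1) hxu rfl hdpos (one_mul _)
    (mul_nonneg (mul_nonneg (by linarith) (by linarith)) hdpos.le)
  have ey := abs_mul_bandWeight_eq (d := (-1 - 1 * (3 * x / D)) / 2) hxu hyr hdpos
    (by rw [hdx, hdy, hy, hz]; field_simp; ring)
    (by
      rw [hdy]
      exact mul_nonneg_of_nonpos_of_nonpos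
        (mul_nonpos_of_nonneg_of_nonpos (by linarith) (by linarith))
        (mul_nonpos_of_nonneg_of_nonpos (by linarith) (by linarith)))
  have ez := abs_mul_bandWeight_eq (d := (-1 - -1 * (3 * x / D)) / 2) hxu hzr hdpos
    (by rw [hdx, hdz, hy, hz]; field_simp; ring)
    (by
      rw [hdz]
      exact mul_nonneg (mul_nonneg_of_nonpos_of_nonpos (by linarith) (by linarith))
        (mul_nonneg_of_nonpos_of_nonpos (by linarith) (by linarith)))
  rw [abs_one, one_mul] at ex
  rw [← rootSum_eq hsum hs rfl hyr hzr (by linarith) (by linarith) (by linarith) k]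
  linear_combination x ^ k * ex + y ^ k * ey + z ^ k * ez

lemma integral_add_add {μ : Measure ℝ} {f g h : ℝ → ℝ} (hf : Integrable f μ)
    (hg : Integrable g μ) (hh : Integrable h μ) :
    ∫ x, f x + g x + h x ∂μ = ∫ x, f x ∂μ + ∫ x, g x ∂μ + ∫ x, h x ∂μ := by
  rw [← integral_add hf hg]
  exact integral_add (hf.add hg) hh

lemma integral_pow_mul_bandWeight {α : ℝ} (hα : -1 < α) (hα2 : α < -(1 / 2))
    (hwi : IntegrableOn (bandWeight α)
      (Set.Icc (-1) α ∪ Set.Icc (-1 - α) (1 + α) ∪ Set.Icc (-α) 1)) (k : ℕ) :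
    IntegrableOn (fun x => x ^ k * bandWeight α x)
      (Set.Icc (-1) α ∪ Set.Icc (-1 - α) (1 + α) ∪ Set.Icc (-α) 1) ∧
    IntegrableOn (fun x => rootSum α (x ^ 3 - (1 + α + α ^ 2) * x) k * arcsineWeight α x)
      (Set.Ioo (-α) 1) ∧
    ∫ x in Set.Icc (-1) α ∪ Set.Icc (-1 - α) (1 + α) ∪ Set.Icc (-α) 1, x ^ k * bandWeight α x =
      ∫ x in Set.Ioo (-α) 1, rootSum α (x ^ 3 - (1 + α + α ^ 2) * x) k * arcsineWeight α x := by
  have hcomp : IsCompact (Set.Icc (-1) α ∪ Set.Icc (-1 - α) (1 + α) ∪ Set.Icc (-α) 1) :=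
    (isCompact_Icc.union isCompact_Icc).union isCompact_Icc
  have hk : IntegrableOn (fun x => x ^ k * bandWeight α x)
      (Set.Icc (-1) α ∪ Set.Icc (-1 - α) (1 + α) ∪ Set.Icc (-α) 1) :=
    hwi.continuousOn_mul (continuous_pow k).continuousOn hcomp
  have hdisc : ∀ x ∈ Set.Icc (-α) 1, 0 < 4 * (1 + α + α ^ 2) - 3 * x ^ 2 := by
    rintro x ⟨h1, h2⟩; nlinarith
  obtain ⟨im1, inj1⟩ := conjRoot_one_image hα hα2
  obtain ⟨im2, inj2⟩ := conjRoot_neg_one_image hα hα2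
  obtain ⟨i1, e1⟩ := integral_image_Icc_of_conjRoot hdisc im1 inj1
    (fun x => x ^ k * bandWeight α x)
  obtain ⟨i2, e2⟩ := integral_image_Icc_of_conjRoot hdisc im2 inj2
    (fun x => x ^ k * bandWeight α x)
  have hkL := hk.left_of_union.left_of_union
  have hkM := hk.left_of_union.right_of_union
  have hkR := hk.right_of_union
  have hkR' := hkR.mono_set Set.Ioo_subset_Icc_self
  have hsum : Set.EqOn (fun x => x ^ k * bandWeight α x +
      |conjRootDeriv (1 + α + α ^ 2) 1 x| * (conjRoot (1 + α + α ^ 2) 1 x ^ k *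
        bandWeight α (conjRoot (1 + α + α ^ 2) 1 x)) +
      |conjRootDeriv (1 + α + α ^ 2) (-1) x| * (conjRoot (1 + α + α ^ 2) (-1) x ^ k *
        bandWeight α (conjRoot (1 + α + α ^ 2) (-1) x)))
      (fun x => rootSum α (x ^ 3 - (1 + α + α ^ 2) * x) k * arcsineWeight α x)
      (Set.Ioo (-α) 1) := fun x hx => weighted_pow_sum_eq hα hα2 hx k
  have hM := i1.1 hkM
  have hL := i2.1 hkL
  refine ⟨hk, ((hkR'.add hM).add hL).congr_fun hsum measurableSet_Ioo, ?_⟩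
  rw [← setIntegral_congr_fun measurableSet_Ioo hsum, integral_add_add hkR' hM hL,
    setIntegral_union _ measurableSet_Icc hk.left_of_union hkR,
    setIntegral_union _ measurableSet_Icc hkL hkM, e1, e2, integral_Icc_eq_integral_Ioo]
  · ring
  · rw [Set.disjoint_left]
    rintro x ⟨_, h1⟩ ⟨h2, _⟩
    linarith
  · rw [Set.disjoint_left]
    rintro x (⟨_, h1⟩ | ⟨_, h1⟩) ⟨h2, _⟩ <;> linarith

lemma arcsineWeight_moments {α : ℝ} (hα : -1 < α) (hα2 : α < -(1 / 2))
    (hwi : IntegrableOn (arcsineWeight α) (Set.Ioo (-α) 1)) :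
    ∫ x in Set.Ioo (-α) 1, (x ^ 3 - (1 + α + α ^ 2) * x) * arcsineWeight α x = 0 ∧
    ∫ x in Set.Ioo (-α) 1, (x ^ 3 - (1 + α + α ^ 2) * x) ^ 2 * arcsineWeight α x =
      (α * (1 + α)) ^ 2 / 2 * ∫ x in Set.Ioo (-α) 1, arcsineWeight α x := by
  set c := α * (1 + α) with hc
  set q : ℝ → ℝ := fun x => x ^ 3 - (1 + α + α ^ 2) * x with hq
  have hle : -α ≤ 1 := by linarith
  have hqc : Continuous q := by fun_prop
  have hqd (x : ℝ) : HasDerivAt q (3 * x ^ 2 - (1 + α + α ^ 2)) x := by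
    have := (hasDerivAt_pow 3 x).sub ((hasDerivAt_id x).const_mul (1 + α + α ^ 2))
    exact this.congr_deriv (by push_cast; ring)
  have hpos : ∀ x ∈ Set.Ioo (-α) 1, 0 < c ^ 2 - q x ^ 2 := by
    rintro x ⟨hx1, hx2⟩
    have : 0 < ((1 - x) * (1 + x)) * (((x - α) * (x + 1 + α)) * ((x - 1 - α) * (x + α))) := by
      apply mul_pos (mul_pos _ _) (mul_pos (mul_pos _ _) (mul_pos _ _)) <;> linarith
    simp only [hc, hq]
    linarith
  have hroot : ∀ x ∈ Set.Ioo (-α) 1, HasDerivAt (fun x => √(c ^ 2 - q x ^ 2))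
      (-(q x * (3 * x ^ 2 - (1 + α + α ^ 2))) / √(c ^ 2 - q x ^ 2)) x := by
    intro x hx
    have := (((hqd x).pow 2).const_sub (c ^ 2)).sqrt (hpos x hx).ne'
    refine this.congr_deriv ?_
    have := (Real.sqrt_pos.2 (hpos x hx)).ne'
    simp only [Pi.pow_apply]
    field_simp
    norm_num
    ring
  have hl : c ^ 2 - q (-α) ^ 2 = 0 := by simp only [hc, hq]; ring
  have hr : c ^ 2 - q 1 ^ 2 = 0 := by simp only [hc, hq]; ring
  have hmul {g : ℝ → ℝ} (hg : Continuous g) :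
      IntegrableOn (fun x => g x * arcsineWeight α x) (Set.Ioo (-α) 1) := by
    rw [← integrableOn_Icc_iff_integrableOn_Ioo] at hwi ⊢
    exact hwi.continuousOn_mul hg.continuousOn isCompact_Icc
  have hFTC {F g : ℝ → ℝ} (hF : Continuous F) (hg : Continuous g) (h0 : F (-α) = 0)
      (h1 : F 1 = 0) (hd : ∀ x ∈ Set.Ioo (-α) 1, HasDerivAt F (g x * arcsineWeight α x) x) :
      ∫ x in Set.Ioo (-α) 1, g x * arcsineWeight α x = 0 := by
    rw [← integral_Ioc_eq_integral_Ioo, ← intervalIntegral.integral_of_le hle,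
      intervalIntegral.integral_eq_sub_of_hasDerivAt_of_le hle hF.continuousOn hd, h0, h1, sub_zero]
    rw [intervalIntegrable_iff_integrableOn_Ioo_of_le hle]
    exact hmul hg
  constructor
  · refine hFTC (F := fun x => -(1 / Real.pi) * √(c ^ 2 - q x ^ 2)) (g := q) (by fun_prop) hqc
      (by simp [hl]) (by simp [hr]) fun x hx => ?_
    refine ((hroot x hx).const_mul _).congr_deriv ?_
    simp only [arcsineWeight, ← hc]
    ring
  · have hz : ∫ x in Set.Ioo (-α) 1, (q x ^ 2 - c ^ 2 / 2) * arcsineWeight α x = 0 := by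
      refine hFTC (F := fun x => -(1 / Real.pi) / 2 * (q x * √(c ^ 2 - q x ^ 2)))
        (g := fun x => q x ^ 2 - c ^ 2 / 2) (by fun_prop) (by fun_prop)
        (by simp [hl]) (by simp [hr]) fun x hx => ?_
      refine (((hqd x).mul (hroot x hx)).const_mul _).congr_deriv ?_
      have h1 := (Real.sqrt_pos.2 (hpos x hx)).ne'
      have h2 := Real.sq_sqrt (hpos x hx).le
      change _ = _ * (1 / Real.pi * (_ / √(c ^ 2 - q x ^ 2)))
      generalize √(c ^ 2 - q x ^ 2) = r at *
      have := Real.pi_ne_zero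
      field_simp
      linear_combination -(3 * x ^ 2 - (1 + α + α ^ 2)) * h2
    have h2 : IntegrableOn (fun x => q x ^ 2 * arcsineWeight α x) (Set.Ioo (-α) 1) :=
      hmul (hqc.pow 2)
    have h3 : IntegrableOn (fun x => c ^ 2 / 2 * arcsineWeight α x) (Set.Ioo (-α) 1) :=
      hwi.const_mul _
    simp only [sub_mul] at hz
    rw [integral_sub h2 h3, integral_const_mul] at hz
    linarith

/-- The first seven moments of the weight, in units of its total mass. -/
lemma bandWeight_moments {α : ℝ} (hα : -1 < α) (hα2 : α < -(1 / 2)) {E : Set ℝ}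
    (hE : E = Set.Icc (-1) α ∪ Set.Icc (-1 - α) (1 + α) ∪ Set.Icc (-α) 1)
    (hwi : IntegrableOn (bandWeight α) E) (c₀ c₁ c₂ c₃ c₄ c₅ c₆ : ℝ) :
    ∫ x in E, (c₀ + c₁ * x + c₂ * x ^ 2 + c₃ * x ^ 3 + c₄ * x ^ 4 + c₅ * x ^ 5 + c₆ * x ^ 6) *
      bandWeight α x =
    (c₀ - c₁ * (1 + 2 * α) + c₂ * (1 + 2 * α + 2 * α ^ 2) -
      c₃ * ((1 + α + α ^ 2) * (1 + 2 * α)) +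
      c₄ * ((1 + α + α ^ 2) * (1 + 2 * α + 2 * α ^ 2)) -
      c₅ * ((1 + α + α ^ 2) ^ 2 * (1 + 2 * α)) +
      c₆ * ((1 + α + α ^ 2) ^ 2 * (1 + 2 * α + 2 * α ^ 2) + (α * (1 + α)) ^ 2 / 2)) *
      ∫ x in E, bandWeight α x := by
  subst hE
  set E := Set.Icc (-1) α ∪ Set.Icc (-1 - α) (1 + α) ∪ Set.Icc (-α) 1
  have hm := integral_pow_mul_bandWeight hα hα2 hwi
  set μ := volume.restrict (Set.Ioo (-α) 1)
  set q : ℝ → ℝ := fun x => x ^ 3 - (1 + α + α ^ 2) * x with hq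
  have hv : Integrable (arcsineWeight α) μ := by
    simpa [rootSum, IntegrableOn] using (hm 0).2.1
  obtain ⟨hq1, hq2⟩ := arcsineWeight_moments hα hα2 hv
  have hmul {g : ℝ → ℝ} (hg : Continuous g) : Integrable (fun x => g x * arcsineWeight α x) μ := by
    have h : IntegrableOn (arcsineWeight α) (Set.Ioo (-α) 1) := hv
    change IntegrableOn (fun x => g x * arcsineWeight α x) (Set.Ioo (-α) 1)
    rw [← integrableOn_Icc_iff_integrableOn_Ioo] at h ⊢
    exact h.continuousOn_mul hg.continuousOn isCompact_Icc
  have hi1 : Integrable (fun x => q x * arcsineWeight α x) μ := hmul (by fun_prop)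
  have hi2 : Integrable (fun x => q x ^ 2 * arcsineWeight α x) μ := hmul (by fun_prop)
  have key (k : ℕ) (r₀ r₁ r₂ : ℝ) (hr : ∀ u, rootSum α u k = r₀ + r₁ * u + r₂ * u ^ 2) :
      ∫ x in E, x ^ k * bandWeight α x =
        (r₀ + r₂ * ((α * (1 + α)) ^ 2 / 2)) * ∫ x, arcsineWeight α x ∂μ := by
    have e (x : ℝ) : rootSum α (q x) k * arcsineWeight α x = r₀ * arcsineWeight α x +
        r₁ * (q x * arcsineWeight α x) + r₂ * (q x ^ 2 * arcsineWeight α x) := by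
      rw [hr]; ring
    rw [(hm k).2.2]
    change ∫ x, rootSum α (q x) k * arcsineWeight α x ∂μ = _
    simp only [e]
    rw [integral_add_add (hv.const_mul _) (hi1.const_mul _) (hi2.const_mul _), integral_const_mul, integral_const_mul,
      integral_const_mul, hq1, hq2]
    ring
  have h0 := key 0 1 0 0 fun u => by simp only [rootSum]; ring
  have h1 := key 1 (-(1 + 2 * α)) 0 0 fun u => by simp only [rootSum]; ring
  have h2 := key 2 (1 + 2 * α + 2 * α ^ 2) 0 0 fun u => by simp only [rootSum]; ring
  have h3 := key 3 (-((1 + α + α ^ 2) * (1 + 2 * α))) 1 0 fun u => by simp only [rootSum]; ring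
  have h4 := key 4 ((1 + α + α ^ 2) * (1 + 2 * α + 2 * α ^ 2)) (-(1 + 2 * α)) 0
    fun u => by simp only [rootSum]; ring
  have h5 := key 5 (-((1 + α + α ^ 2) ^ 2 * (1 + 2 * α)))
    ((1 + α + α ^ 2) + (1 + 2 * α + 2 * α ^ 2)) 0 fun u => by simp only [rootSum]; ring
  have h6 := key 6 ((1 + α + α ^ 2) ^ 2 * (1 + 2 * α + 2 * α ^ 2))
    (-2 * (1 + α + α ^ 2) * (1 + 2 * α)) 1 fun u => by simp only [rootSum]; ring
  have hk (k : ℕ) (c : ℝ) :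
      Integrable (fun x => c * (x ^ k * bandWeight α x)) (volume.restrict E) :=
    Integrable.const_mul (hm k).1 c
  have e (x : ℝ) : (c₀ + c₁ * x + c₂ * x ^ 2 + c₃ * x ^ 3 + c₄ * x ^ 4 + c₅ * x ^ 5 +
      c₆ * x ^ 6) * bandWeight α x =
      ∑ i : Fin 7, ![c₀, c₁, c₂, c₃, c₄, c₅, c₆] i * (x ^ (i : ℕ) * bandWeight α x) := by
    simp only [Fin.sum_univ_seven, Matrix.cons_val, Fin.isValue, Fin.coe_ofNat_eq_mod]
    norm_num
    ring
  have hw : ∫ x in E, bandWeight α x = ∫ x in E, x ^ 0 * bandWeight α x := by simp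
  simp only [e]
  rw [integral_finsetSum Finset.univ fun (i : Fin 7) _ =>
    hk (i : ℕ) (![c₀, c₁, c₂, c₃, c₄, c₅, c₆] i)]
  simp only [integral_const_mul, Fin.sum_univ_seven, Matrix.cons_val, Fin.isValue,
    Fin.coe_ofNat_eq_mod, Nat.reduceMod]
  rw [hw, h0, h1, h2, h3, h4, h5, h6]
  ring

/-- the first three monic orthogonal polynomials and the first recurrence
coefficients for the symmetric `K = 3`, genus-2 case. -/
theorem symmetric_genus_two_first_polynomials
    (α : ℝ) (hα : -1 < α) (hα2 : α < -(1 / 2))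
    (E : Set ℝ)
    (hE : E = Set.Icc (-1) α ∪ Set.Icc (-1 - α) (1 + α) ∪ Set.Icc (-α) 1)
    (w : ℝ → ℝ)
    (hw : ∀ x, w x = (1 / Real.pi) *
        Real.sqrt ((x - α) * (x - 1 - α) / ((1 - x ^ 2) * (x + 1 + α) * (x + α))))
    (hw0 : ∀ x ∈ E, 0 ≤ w x)
    (hwint : MeasureTheory.IntegrableOn w E)
    (P : ℕ → Polynomial ℝ) (h : ℕ → ℝ) (a b : ℕ → ℝ)
    (hPmonic : ∀ n, (P n).Monic)
    (hPdeg : ∀ n, (P n).natDegree = n)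
    (hh : ∀ n, 0 < h n)
    (horth : ∀ n m, ∫ x in E, (P n).eval x * (P m).eval x * w x = if n = m then h n else 0)
    (ha : ∀ n, 1 ≤ n → 0 < a n)
    (hrec0 : P 1 = (Polynomial.X - Polynomial.C (b 1)) * P 0)
    (hrec : ∀ n, 1 ≤ n →
      P (n + 1) = (Polynomial.X - Polynomial.C (b (n + 1))) * P n - Polynomial.C (a n) * P (n - 1)) :
    (P 1 = Polynomial.X + Polynomial.C (2 * α + 1) ∧
      P 2 = Polynomial.X ^ 2 + Polynomial.C (α + 1 / 2) * Polynomial.X - Polynomial.C (1 / 2) ∧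
      P 3 = Polynomial.X ^ 3 - Polynomial.C (1 + α + α ^ 2) * Polynomial.X) ∧
    (b 1 = -(1 + 2 * α) ∧ b 2 = 1 / 2 + α ∧ b 3 = 1 / 2 + α ∧
      a 1 = -2 * α * (1 + α) ∧ a 2 = 1 / 4 ∧ a 3 = -α * (1 + α)) := by
  obtain rfl : w = bandWeight α := funext hw
  have mom := bandWeight_moments hα hα2 hE hwint
  set m := ∫ x in E, bandWeight α x with hm
  have hP0 : P 0 = 1 := (hPmonic 0).natDegree_eq_zero.1 (hPdeg 0)
  have hm0 : m ≠ 0 := by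
    have := horth 0 0
    simp only [hP0, eval_one, one_mul, if_true] at this
    rw [hm, this]
    exact (hh 0).ne'
  have hα0 : α * (1 + α) ≠ 0 := mul_ne_zero (by linarith) (by linarith)
  have orth {i j : ℕ} (hij : i ≠ j) (c₀ c₁ c₂ c₃ c₄ c₅ c₆ : ℝ)
      (hc : ∀ x, (P i).eval x * (P j).eval x =
        c₀ + c₁ * x + c₂ * x ^ 2 + c₃ * x ^ 3 + c₄ * x ^ 4 + c₅ * x ^ 5 + c₆ * x ^ 6) := by
    have h1 := horth i j
    simp only [hc, if_neg hij] at h1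
    exact (mul_eq_zero.1 ((mom c₀ c₁ c₂ c₃ c₄ c₅ c₆).symm.trans h1)).resolve_right hm0
  have hP2' := hrec 1 le_rfl
  have hP3' := hrec 2 (by norm_num)
  have hP4' := hrec 3 (by norm_num)
  simp only [Nat.reduceAdd, Nat.reduceSub] at hP2' hP3' hP4'
  have hb1 : b 1 = -(1 + 2 * α) := by
    have := orth (i := 1) (j := 0) (by norm_num) (-b 1) 1 0 0 0 0 0 fun x => by
      simp only [hrec0, hP0, eval_one, eval_mul, eval_sub, eval_X, eval_C]; ring
    linear_combination -this
  have hP1 : P 1 = X + C (2 * α + 1) := by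
    rw [hrec0, hP0, hb1, mul_one, sub_eq_add_neg, ← C_neg]; congr 2; ring
  have e1 (x : ℝ) : (P 1).eval x = x + (2 * α + 1) := by simp [hP1]
  have e2 (x : ℝ) : (P 2).eval x = (x - b 2) * (x + (2 * α + 1)) - a 1 := by
    simp [hP2', e1, hP0]
  have ha1 : a 1 = -2 * α * (1 + α) := by
    have := orth (i := 2) (j := 0) (by norm_num) (-b 2 * (2 * α + 1) - a 1)
      (-b 2 + (2 * α + 1)) 1 0 0 0 0 fun x => by rw [e2, hP0, eval_one]; ring
    linear_combination -this
  have hb2 : b 2 = 1 / 2 + α := by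
    have := orth (i := 2) (j := 1) (by norm_num) ((-b 2 * (2 * α + 1) - a 1) * (2 * α + 1))
      ((-b 2 * (2 * α + 1) - a 1) + (-b 2 + (2 * α + 1)) * (2 * α + 1))
      ((-b 2 + (2 * α + 1)) + (2 * α + 1)) 1 0 0 0 fun x => by rw [e2, e1]; ring
    rw [ha1] at this
    refine mul_left_cancel₀ hα0 ?_
    linear_combination this / 2
  have hP2 : P 2 = X ^ 2 + C (α + 1 / 2) * X - C (1 / 2) := by
    refine Polynomial.funext fun x => ?_
    rw [e2, ha1, hb2]
    simp only [eval_add, eval_sub, eval_mul, eval_pow, eval_X, eval_C]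
    ring
  have e2' (x : ℝ) : (P 2).eval x = x ^ 2 + (α + 1 / 2) * x - 1 / 2 := by
    rw [hP2]; simp only [eval_add, eval_sub, eval_mul, eval_pow, eval_X, eval_C]
  have e3 (x : ℝ) : (P 3).eval x = x ^ 3 + (α + 1 / 2 - b 3) * x ^ 2 +
      (-1 / 2 - b 3 * (α + 1 / 2) - a 2) * x + (b 3 / 2 - a 2 * (2 * α + 1)) := by
    simp only [hP3', eval_sub, eval_mul, eval_X, eval_C, e2', e1]; ring
  have ha2 : a 2 = 1 / 4 := by
    have := orth (i := 3) (j := 1) (by norm_num) ((b 3 / 2 - a 2 * (2 * α + 1)) * (2 * α + 1))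
      ((b 3 / 2 - a 2 * (2 * α + 1)) + (-1 / 2 - b 3 * (α + 1 / 2) - a 2) * (2 * α + 1))
      ((-1 / 2 - b 3 * (α + 1 / 2) - a 2) + (α + 1 / 2 - b 3) * (2 * α + 1))
      ((α + 1 / 2 - b 3) + (2 * α + 1)) 1 0 0 fun x => by rw [e3, e1]; ring
    refine mul_left_cancel₀ hα0 ?_
    linear_combination this / 2
  have hb3 : b 3 = 1 / 2 + α := by
    have := orth (i := 3) (j := 2) (by norm_num) (-(b 3 / 2 - a 2 * (2 * α + 1)) / 2)
      ((α + 1 / 2) * (b 3 / 2 - a 2 * (2 * α + 1)) - (-1 / 2 - b 3 * (α + 1 / 2) - a 2) / 2)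
      ((b 3 / 2 - a 2 * (2 * α + 1)) + (α + 1 / 2) * (-1 / 2 - b 3 * (α + 1 / 2) - a 2) -
        (α + 1 / 2 - b 3) / 2)
      ((-1 / 2 - b 3 * (α + 1 / 2) - a 2) + (α + 1 / 2) * (α + 1 / 2 - b 3) - 1 / 2)
      ((α + 1 / 2 - b 3) + (α + 1 / 2)) 1 0 fun x => by rw [e3, e2']; ring
    rw [ha2] at this
    refine mul_left_cancel₀ hα0 ?_
    linear_combination 2 * this
  have hP3 : P 3 = X ^ 3 - C (1 + α + α ^ 2) * X := by
    refine Polynomial.funext fun x => ?_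
    rw [e3, ha2, hb3]
    simp only [eval_sub, eval_mul, eval_pow, eval_X, eval_C]
    ring
  have ha3 : a 3 = -α * (1 + α) := by
    have := orth (i := 4) (j := 2) (by norm_num) (-a 3 / 4)
      (-((1 + α + α ^ 2) * b 4 - a 3 * (α + 1 / 2)) / 2 + a 3 * (α + 1 / 2) / 2)
      (((1 + α + α ^ 2) + a 3) / 2 +
        ((1 + α + α ^ 2) * b 4 - a 3 * (α + 1 / 2)) * (α + 1 / 2) + a 3 / 2)
      (b 4 / 2 - ((1 + α + α ^ 2) + a 3) * (α + 1 / 2) + (1 + α + α ^ 2) * b 4 -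
        a 3 * (α + 1 / 2))
      (-1 / 2 - b 4 * (α + 1 / 2) - ((1 + α + α ^ 2) + a 3)) (α + 1 / 2 - b 4) 1
      fun x => by
        simp only [hP4', hP3, eval_sub, eval_mul, eval_pow, eval_X, eval_C, e2']; ring
    refine mul_left_cancel₀ hα0 ?_
    linear_combination 2 * this
  exact ⟨⟨hP1, hP2, hP3⟩, hb1, hb2, hb3, ha1, ha2, ha3⟩
end
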